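/- arXiv:math/9910003 — 2 statements merged into one kernel-verified Lean document; each statement's English description precedes it below -/
import Mathlib

section
/- Let Δ be a reduced crystallographic irreducible root system spanning a finite-dimensional real inner product space V, with Weyl group W, base Π = {α_1, …, α_l}, positive system Δ⁺, and highest root θ, and normalize the inner product so that (θ|θ) = 2. Let μ : Δ → ℝ be W-invariant and set ρ_μ := (1/2) Σ_{α ∈ Δ⁺} μ(α) α. Then for every λ ∈ V, (1/2) Σ_{α ∈ Δ} μ(α) (α|λ) α = ((ρ_μ|θ) + μ(θ)) λ. -/
open scoped RealInnerProductSpace BigOperators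

variable {V : Type*} [NormedAddCommGroup V] [InnerProductSpace ℝ V]

/-- The orthogonal reflection `s_α : x ↦ x − (2 (x|α)/(α|α)) α` in the hyperplane
orthogonal to `α`, as a linear automorphism of `V`. -/
noncomputable def rootReflection (α : V) : V ≃ₗ[ℝ] V where
  toFun x := x - (2 * ⟪x, α⟫ / ⟪α, α⟫) • α
  invFun x := x - (2 * ⟪x, α⟫ / ⟪α, α⟫) • α
  map_add' x y := by
    simp only [inner_add_left]
    rw [show 2 * (⟪x, α⟫ + ⟪y, α⟫) / ⟪α, α⟫
        = 2 * ⟪x, α⟫ / ⟪α, α⟫ + 2 * ⟪y, α⟫ / ⟪α, α⟫ by ring, add_smul]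
    abel
  map_smul' c x := by
    simp only [real_inner_smul_left, RingHom.id_apply, smul_sub, smul_smul]
    rw [show 2 * (c * ⟪x, α⟫) / ⟪α, α⟫ = c * (2 * ⟪x, α⟫ / ⟪α, α⟫) by ring]
  left_inv x := by
    rcases eq_or_ne α 0 with h | h
    · simp [h]
    · have hα : ⟪α, α⟫ ≠ 0 := inner_self_ne_zero.mpr h
      simp only [inner_sub_left, real_inner_smul_left]
      rw [show 2 * (⟪x, α⟫ - 2 * ⟪x, α⟫ / ⟪α, α⟫ * ⟪α, α⟫) / ⟪α, α⟫
          = -(2 * ⟪x, α⟫ / ⟪α, α⟫) by field_simp; ring]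
      module
  right_inv x := by
    rcases eq_or_ne α 0 with h | h
    · simp [h]
    · have hα : ⟪α, α⟫ ≠ 0 := inner_self_ne_zero.mpr h
      simp only [inner_sub_left, real_inner_smul_left]
      rw [show 2 * (⟪x, α⟫ - 2 * ⟪x, α⟫ / ⟪α, α⟫ * ⟪α, α⟫) / ⟪α, α⟫
          = -(2 * ⟪x, α⟫ / ⟪α, α⟫) by field_simp; ring]
      module

/-- `Δ` is a reduced crystallographic root system in the real inner product space `V`. -/
structure IsRootSystem {V : Type*} [NormedAddCommGroup V] [InnerProductSpace ℝ V]
    (Δ : Finset V) : Prop where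
  /-- `0 ∉ Δ`. -/
  ne_zero : ∀ α ∈ Δ, α ≠ 0
  /-- `Δ` spans `V`. -/
  span_eq_top : Submodule.span ℝ (Δ : Set V) = ⊤
  /-- each reflection `s_α` maps `Δ` onto itself. -/
  reflect_mem : ∀ α ∈ Δ, ∀ β ∈ Δ, β - (2 * ⟪β, α⟫ / ⟪α, α⟫) • α ∈ Δ
  /-- crystallographic condition: `2(α|β)/(β|β) ∈ ℤ`. -/
  crystallographic : ∀ α ∈ Δ, ∀ β ∈ Δ, ∃ n : ℤ, 2 * ⟪α, β⟫ / ⟪β, β⟫ = (n : ℝ)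
  /-- reduced: `ℝα ∩ Δ = {α, −α}`. -/
  reduced : ∀ α ∈ Δ, ∀ t : ℝ, t • α ∈ Δ → t = 1 ∨ t = -1

/-- The Weyl group of `Δ`: the group of (orthogonal) transformations of `V` generated by
the reflections `s_α`, `α ∈ Δ`. -/
noncomputable def weylGroup (Δ : Finset V) : Subgroup (V ≃ₗ[ℝ] V) :=
  Subgroup.closure {g | ∃ α ∈ Δ, g = rootReflection α}

/-- `Δ` is irreducible: the only subspaces of `V` invariant under the Weyl group
are `{0}` and `V`. -/
def IsIrreducibleRS (Δ : Finset V) : Prop :=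
  ∀ U : Submodule ℝ V, (∀ w ∈ weylGroup Δ, ∀ x ∈ U, w x ∈ U) → U = ⊥ ∨ U = ⊤

/-- `b` is a base of `Δ`: a basis of `V` consisting of roots such that every root is an
integer combination of the base with coefficients all nonnegative or all nonpositive. -/
structure IsBase {V : Type*} [NormedAddCommGroup V] [InnerProductSpace ℝ V]
    (Δ : Finset V) {ι : Type*} [Fintype ι] (b : Module.Basis ι ℝ V) : Prop where
  mem : ∀ i, b i ∈ Δ
  int_coeff : ∀ α ∈ Δ, ∀ i, ∃ n : ℤ, b.repr α i = (n : ℝ)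
  same_sign : ∀ α ∈ Δ, (∀ i, 0 ≤ b.repr α i) ∨ (∀ i, b.repr α i ≤ 0)

open Classical in
/-- The set `Δ⁺` of positive roots with respect to the base `b`. -/
noncomputable def posRoots (Δ : Finset V) {ι : Type*} [Fintype ι] (b : Module.Basis ι ℝ V) :
    Finset V :=
  Δ.filter fun α => ∀ i, 0 ≤ b.repr α i

section WeightedRootOperator

variable {Δ : Finset V}

lemma rootReflection_apply (α x : V) :
    rootReflection α x = x - (2 * ⟪x, α⟫ / ⟪α, α⟫) • α := rfl

lemma inner_rootReflection_left (α x y : V) :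
    ⟪rootReflection α x, y⟫ = ⟪x, rootReflection α y⟫ := by
  simp only [rootReflection_apply, inner_sub_left, inner_sub_right, real_inner_smul_left,
    real_inner_smul_right, real_inner_comm α y]
  ring

lemma rootReflection_involutive (α x : V) : rootReflection α (rootReflection α x) = x :=
  (rootReflection α).left_inv x

lemma rootReflection_self {α : V} (hα : α ≠ 0) : rootReflection α α = -α := by
  have h : ⟪α, α⟫ ≠ 0 := inner_self_ne_zero.mpr hα
  rw [rootReflection_apply, mul_div_assoc, div_self h]
  module

lemma rootReflection_mem_weylGroup {α : V} (hα : α ∈ Δ) : rootReflection α ∈ weylGroup Δ :=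
  Subgroup.subset_closure ⟨α, hα, rfl⟩

namespace IsRootSystem

lemma neg_mem (hΔ : IsRootSystem Δ) {α : V} (hα : α ∈ Δ) : -α ∈ Δ := by
  rw [← rootReflection_self (hΔ.ne_zero α hα)]
  exact hΔ.reflect_mem α hα α hα

lemma weyl_invariant_neg (hΔ : IsRootSystem Δ) {μ : V → ℝ}
    (hμ : ∀ w ∈ weylGroup Δ, ∀ α ∈ Δ, μ (w α) = μ α) {α : V} (hα : α ∈ Δ) : μ (-α) = μ α := by
  rw [← rootReflection_self (hΔ.ne_zero α hα)]
  exact hμ _ (rootReflection_mem_weylGroup hα) α hα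

end IsRootSystem

/-- The operator `x ↦ Σ_{α ∈ Δ} μ(α) (α|x) α`. -/
noncomputable def weightedRootOperator (Δ : Finset V) (μ : V → ℝ) : V →ₗ[ℝ] V where
  toFun x := ∑ α ∈ Δ, (μ α * ⟪α, x⟫) • α
  map_add' x y := by simp only [inner_add_right, mul_add, add_smul, Finset.sum_add_distrib]
  map_smul' c x := by
    simp only [real_inner_smul_right, RingHom.id_apply, Finset.smul_sum, smul_smul]
    exact Finset.sum_congr rfl fun α _ => by congr 1; ring

lemma weightedRootOperator_apply (μ : V → ℝ) (x : V) :
    weightedRootOperator Δ μ x = ∑ α ∈ Δ, (μ α * ⟪α, x⟫) • α := rfl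

lemma inner_weightedRootOperator_left (μ : V → ℝ) (x y : V) :
    ⟪weightedRootOperator Δ μ x, y⟫ = ∑ α ∈ Δ, μ α * ⟪α, x⟫ * ⟪α, y⟫ := by
  simp only [weightedRootOperator_apply, sum_inner, real_inner_smul_left]

lemma weightedRootOperator_isSymmetric (μ : V → ℝ) :
    (weightedRootOperator Δ μ).IsSymmetric := fun x y => by
  rw [inner_weightedRootOperator_left, real_inner_comm _ x, inner_weightedRootOperator_left]
  exact Finset.sum_congr rfl fun α _ => by ring

lemma weightedRootOperator_rootReflection (hΔ : IsRootSystem Δ) {μ : V → ℝ}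
    (hμ : ∀ w ∈ weylGroup Δ, ∀ α ∈ Δ, μ (w α) = μ α) {β : V} (hβ : β ∈ Δ) (x : V) :
    weightedRootOperator Δ μ (rootReflection β x) =
      rootReflection β (weightedRootOperator Δ μ x) := by
  rw [weightedRootOperator_apply, weightedRootOperator_apply, map_sum]
  have hmem : ∀ α ∈ Δ, rootReflection β α ∈ Δ := hΔ.reflect_mem β hβ
  refine Finset.sum_nbij' (rootReflection β) (rootReflection β) hmem hmem
    (fun α _ => rootReflection_involutive β α) (fun α _ => rootReflection_involutive β α) ?_
  intro α hα
  rw [map_smul, rootReflection_involutive, inner_rootReflection_left,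
    hμ _ (rootReflection_mem_weylGroup hβ) α hα]

lemma weightedRootOperator_weylGroup (hΔ : IsRootSystem Δ) {μ : V → ℝ}
    (hμ : ∀ w ∈ weylGroup Δ, ∀ α ∈ Δ, μ (w α) = μ α) {w : V ≃ₗ[ℝ] V} (hw : w ∈ weylGroup Δ)
    (x : V) : weightedRootOperator Δ μ (w x) = w (weightedRootOperator Δ μ x) := by
  induction hw using Subgroup.closure_induction generalizing x with
  | mem w hw =>
    obtain ⟨β, hβ, rfl⟩ := hw
    exact weightedRootOperator_rootReflection hΔ hμ hβ x
  | one => rfl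
  | mul w₁ w₂ _ _ h₁ h₂ => rw [LinearEquiv.mul_apply, LinearEquiv.mul_apply, h₁, h₂]
  | inv w _ h =>
    apply w.injective
    rw [← h, ← LinearEquiv.mul_apply, ← LinearEquiv.mul_apply, mul_inv_cancel]
    rfl

/-- Schur's lemma for the weighted root operator of an irreducible root system. -/
lemma exists_weightedRootOperator_eq_smul [FiniteDimensional ℝ V] [Nontrivial V]
    (hΔ : IsRootSystem Δ) (hirr : IsIrreducibleRS Δ) {μ : V → ℝ}
    (hμ : ∀ w ∈ weylGroup Δ, ∀ α ∈ Δ, μ (w α) = μ α) :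
    ∃ c : ℝ, ∀ x, weightedRootOperator Δ μ x = c • x := by
  obtain ⟨c, hc⟩ : ∃ c : ℝ, Module.End.HasEigenvalue (weightedRootOperator Δ μ) c :=
    ⟨_, (weightedRootOperator_isSymmetric μ).hasEigenvalue_iSup_of_finiteDimensional⟩
  refine ⟨c, fun x => ?_⟩
  have hinv : ∀ w ∈ weylGroup Δ, ∀ x ∈ Module.End.eigenspace (weightedRootOperator Δ μ) c,
      w x ∈ Module.End.eigenspace (weightedRootOperator Δ μ) c := by
    intro w hw x hx
    rw [Module.End.mem_eigenspace_iff] at hx ⊢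
    rw [weightedRootOperator_weylGroup hΔ hμ hw, hx, map_smul]
  rcases hirr _ hinv with h | h
  · exact absurd h hc
  · exact Module.End.mem_eigenspace_iff.mp (h ▸ Submodule.mem_top)

end WeightedRootOperator

section HighestRoot

variable {ι : Type*} {Δ : Finset V} {b : Module.Basis ι ℝ V} {θ : V}

lemma repr_highestRoot_nonneg (hΔ : IsRootSystem Δ) (hθΔ : θ ∈ Δ)
    (hle : ∀ α ∈ Δ, ∀ i, b.repr α i ≤ b.repr θ i) (i : ι) : 0 ≤ b.repr θ i := by
  have h := hle _ (hΔ.neg_mem hθΔ) i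
  simp only [map_neg, Finsupp.neg_apply] at h
  linarith

variable [Fintype ι]

lemma mem_posRoots {α : V} : α ∈ posRoots Δ b ↔ α ∈ Δ ∧ ∀ i, 0 ≤ b.repr α i := by
  simp [posRoots]

lemma neg_notMem_posRoots (hΔ : IsRootSystem Δ) {α : V} (hα : α ∈ posRoots Δ b) :
    -α ∉ posRoots Δ b := by
  intro hneg
  rw [mem_posRoots] at hα hneg
  refine hΔ.ne_zero α hα.1 (b.ext_elem fun i => ?_)
  have h := hneg.2 i
  simp only [map_neg, Finsupp.neg_apply] at h
  simpa using le_antisymm (by linarith) (hα.2 i)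

lemma neg_mem_posRoots (hΔ : IsRootSystem Δ) (hb : IsBase Δ b) {α : V} (hα : α ∈ Δ)
    (hpos : α ∉ posRoots Δ b) : -α ∈ posRoots Δ b := by
  rw [mem_posRoots] at hpos ⊢
  refine ⟨hΔ.neg_mem hα, fun i => ?_⟩
  rcases hb.same_sign α hα with h | h
  · exact absurd ⟨hα, h⟩ hpos
  · simpa using h i

lemma sum_eq_two_mul_sum_posRoots (hΔ : IsRootSystem Δ) (hb : IsBase Δ b) {f : V → ℝ}
    (hf : ∀ α ∈ Δ, f (-α) = f α) : ∑ α ∈ Δ, f α = 2 * ∑ α ∈ posRoots Δ b, f α := by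
  classical
  have hsub : posRoots Δ b ⊆ Δ := fun α hα => (mem_posRoots.mp hα).1
  have hneg : ∑ α ∈ Δ \ posRoots Δ b, f α = ∑ α ∈ posRoots Δ b, f α := by
    refine Finset.sum_nbij' Neg.neg Neg.neg ?_ ?_ (fun α _ => neg_neg α) (fun α _ => neg_neg α) ?_
    · intro α hα
      rw [Finset.mem_sdiff] at hα
      exact neg_mem_posRoots hΔ hb hα.1 hα.2
    · intro α hα
      exact Finset.mem_sdiff.mpr ⟨hΔ.neg_mem (hsub hα), neg_notMem_posRoots hΔ hα⟩
    · intro α hα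
      exact (hf α (Finset.mem_sdiff.mp hα).1).symm
  rw [← Finset.sum_sdiff hsub, hneg, two_mul]

lemma inner_highestRoot_nonneg (hΔ : IsRootSystem Δ) (hθΔ : θ ∈ Δ)
    (hle : ∀ α ∈ Δ, ∀ i, b.repr α i ≤ b.repr θ i) {α : V} (hα : α ∈ posRoots Δ b) :
    0 ≤ ⟪α, θ⟫ := by
  by_contra! hlt
  obtain ⟨hαΔ, hpos⟩ := mem_posRoots.mp hα
  have hα0 := hΔ.ne_zero α hαΔ
  have hk : 2 * ⟪θ, α⟫ / ⟪α, α⟫ < 0 := by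
    rw [real_inner_comm]
    exact div_neg_of_neg_of_pos (by linarith) (real_inner_self_pos.mpr hα0)
  refine hα0 (b.ext_elem fun i => ?_)
  have h := hle _ (hΔ.reflect_mem α hαΔ θ hθΔ) i
  simp only [map_sub, map_smul, Finsupp.sub_apply, Finsupp.smul_apply, smul_eq_mul] at h
  have hi := hpos i
  have : b.repr α i = 0 := by nlinarith
  simpa using this

lemma inner_highestRoot_eq_zero_or_one (hΔ : IsRootSystem Δ) (hθΔ : θ ∈ Δ)
    (hle : ∀ α ∈ Δ, ∀ i, b.repr α i ≤ b.repr θ i) (hnorm : ⟪θ, θ⟫ = 2) {α : V}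
    (hα : α ∈ posRoots Δ b) (hne : α ≠ θ) : ⟪α, θ⟫ = 0 ∨ ⟪α, θ⟫ = 1 := by
  have hαΔ := (mem_posRoots.mp hα).1
  have h0 := inner_highestRoot_nonneg hΔ hθΔ hle hα
  obtain ⟨n, hn⟩ := hΔ.crystallographic α hαΔ θ hθΔ
  have hn' : 2 * ⟪α, θ⟫ / ⟪θ, θ⟫ = ⟪α, θ⟫ := by rw [hnorm]; ring
  rw [hn'] at hn
  have hlt : n < 2 := by
    by_contra! h2
    refine hne (b.ext_elem fun i => ?_)
    have hmem := hΔ.neg_mem (hΔ.reflect_mem θ hθΔ α hαΔ)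
    rw [hn', hn] at hmem
    have h := hle _ hmem i
    simp only [map_neg, map_sub, map_smul, Finsupp.neg_apply, Finsupp.sub_apply,
      Finsupp.smul_apply, smul_eq_mul] at h
    have hnn := repr_highestRoot_nonneg hΔ hθΔ hle i
    have h2' : (2 : ℝ) ≤ n := by exact_mod_cast h2
    exact le_antisymm (hle α hαΔ i) (by nlinarith)
  have hn0 : 0 ≤ n := by exact_mod_cast hn ▸ h0
  rw [hn]
  have : n = 0 ∨ n = 1 := by omega
  exact_mod_cast this

lemma sum_posRoots_mul_inner_highestRoot_sq (hΔ : IsRootSystem Δ) (hθΔ : θ ∈ Δ)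
    (hle : ∀ α ∈ Δ, ∀ i, b.repr α i ≤ b.repr θ i) (hnorm : ⟪θ, θ⟫ = 2) (μ : V → ℝ) :
    ∑ α ∈ posRoots Δ b, μ α * ⟪α, θ⟫ * ⟪α, θ⟫ =
      ∑ α ∈ posRoots Δ b, μ α * ⟪α, θ⟫ + 2 * μ θ := by
  classical
  have hθ : θ ∈ posRoots Δ b :=
    mem_posRoots.mpr ⟨hθΔ, repr_highestRoot_nonneg hΔ hθΔ hle⟩
  rw [← Finset.add_sum_erase _ _ hθ, ← Finset.add_sum_erase _ _ hθ, hnorm]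
  have h : ∀ α ∈ (posRoots Δ b).erase θ, μ α * ⟪α, θ⟫ * ⟪α, θ⟫ = μ α * ⟪α, θ⟫ := by
    intro α hα
    rw [Finset.mem_erase] at hα
    rcases inner_highestRoot_eq_zero_or_one hΔ hθΔ hle hnorm hα.2 hα.1 with h | h <;> simp [h]
  rw [Finset.sum_congr rfl h]
  ring

end HighestRoot

/-- For an irreducible reduced crystallographic root system `Δ` with base `b`, positive
roots `Δ⁺`, highest root `θ` normalized by `(θ|θ) = 2`, and a Weyl-invariant `μ`, setting
`ρ_μ = (1/2) Σ_{α ∈ Δ⁺} μ(α) α`, one has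
`(1/2) Σ_{α ∈ Δ} μ(α) (α|λ) α = ((ρ_μ|θ) + μ(θ)) λ` for every `λ ∈ V`. -/
theorem sum_root_inner_smul_eq_dual_coxeter_smul {V : Type*} [NormedAddCommGroup V]
    [InnerProductSpace ℝ V] [FiniteDimensional ℝ V] {ι : Type*} [Fintype ι]
    (Δ : Finset V) (hΔ : IsRootSystem Δ) (hirr : IsIrreducibleRS Δ)
    (b : Module.Basis ι ℝ V) (hb : IsBase Δ b)
    (θ : V) (hθΔ : θ ∈ Δ)
    (hθ : ∀ α ∈ Δ, ∃ c : ι → ℕ, θ - α = ∑ i, (c i : ℝ) • b i)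
    (hnorm : ⟪θ, θ⟫ = 2)
    (μ : V → ℝ) (hμ : ∀ w ∈ weylGroup Δ, ∀ α ∈ Δ, μ (w α) = μ α) :
    ∀ l : V, (1 / 2 : ℝ) • ∑ α ∈ Δ, (μ α * ⟪α, l⟫) • α =
      (⟪(1 / 2 : ℝ) • ∑ α ∈ posRoots Δ b, μ α • α, θ⟫ + μ θ) • l := by
  have hle : ∀ α ∈ Δ, ∀ i, b.repr α i ≤ b.repr θ i := by
    intro α hα i
    obtain ⟨c, hc⟩ := hθ α hα
    have h := congrArg (fun v => b.repr v i) hc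
    simp only [map_sub, Finsupp.sub_apply, b.repr_sum_self] at h
    have : (0 : ℝ) ≤ c i := Nat.cast_nonneg _
    linarith
  have : Nontrivial V := ⟨θ, 0, hΔ.ne_zero θ hθΔ⟩
  obtain ⟨c, hc⟩ := exists_weightedRootOperator_eq_smul hΔ hirr hμ
  intro l
  rw [← weightedRootOperator_apply, hc, smul_smul]
  congr 1
  have hsq := inner_weightedRootOperator_left (Δ := Δ) μ θ θ
  rw [hc, real_inner_smul_left, hnorm, sum_eq_two_mul_sum_posRoots hΔ hb,
    sum_posRoots_mul_inner_highestRoot_sq hΔ hθΔ hle hnorm] at hsq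
  · simp only [real_inner_smul_left, sum_inner]
    linarith
  · intro α hα
    rw [hΔ.weyl_invariant_neg hμ hα, inner_neg_left]
    ring
end

section
/- Let Δ be a reduced crystallographic irreducible root system spanning a finite-dimensional real inner product space V, with base Π, positive system Δ⁺ and highest root θ. Then for every positive root α ∈ Δ⁺ with α ≠ θ, the pairing ⟨α, θ^∨⟩ := 2(α|θ)/(θ|θ) is equal to 0 or 1; and ⟨θ, θ^∨⟩ = 2. -/
open scoped RealInnerProductSpace BigOperators

variable {V : Type*} [NormedAddCommGroup V] [InnerProductSpace ℝ V]

/-- A root system is stable under negation. -/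
theorem IsRootSystem.neg_mem_s5 {V : Type*} [NormedAddCommGroup V] [InnerProductSpace ℝ V]
    {Δ : Finset V} (hΔ : IsRootSystem Δ) {α : V} (hα : α ∈ Δ) : -α ∈ Δ := by
  have h := hΔ.reflect_mem α hα α hα
  rwa [mul_div_cancel_right₀ _ (inner_self_ne_zero.mpr (hΔ.ne_zero α hα)),
    show α - (2 : ℝ) • α = -α by module] at h

/-- Every root has coordinates at most those of the highest root. -/
theorem repr_le_repr_of_highest {V : Type*} [NormedAddCommGroup V] [InnerProductSpace ℝ V]
    {ι : Type*} [Fintype ι] {Δ : Finset V} {b : Module.Basis ι ℝ V} {θ : V}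
    (hθ : ∀ α ∈ Δ, ∃ c : ι → ℕ, θ - α = ∑ i, (c i : ℝ) • b i)
    {α : V} (hα : α ∈ Δ) (i : ι) : b.repr α i ≤ b.repr θ i := by
  obtain ⟨c, hc⟩ := hθ α hα
  have h : b.repr (θ - α) i = c i := by rw [hc, b.repr_sum_self]
  rw [map_sub, Finsupp.sub_apply] at h
  have := Nat.cast_nonneg (α := ℝ) (c i)
  linarith

/-- The highest root has nonnegative coordinates. -/
theorem repr_nonneg_of_highest {V : Type*} [NormedAddCommGroup V] [InnerProductSpace ℝ V]
    {ι : Type*} [Fintype ι] {Δ : Finset V} (hΔ : IsRootSystem Δ)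
    {b : Module.Basis ι ℝ V} {θ : V} (hθΔ : θ ∈ Δ)
    (hθ : ∀ α ∈ Δ, ∃ c : ι → ℕ, θ - α = ∑ i, (c i : ℝ) • b i) (i : ι) :
    0 ≤ b.repr θ i := by
  have h := repr_le_repr_of_highest hθ (hΔ.neg_mem_s5 hθΔ) i
  rw [map_neg, Finsupp.neg_apply] at h
  linarith

/-- The highest root is dominant. -/
theorem inner_base_highest_nonneg {V : Type*} [NormedAddCommGroup V] [InnerProductSpace ℝ V]
    {ι : Type*} [Fintype ι] {Δ : Finset V} (hΔ : IsRootSystem Δ)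
    {b : Module.Basis ι ℝ V} (hb : IsBase Δ b) {θ : V} (hθΔ : θ ∈ Δ)
    (hθ : ∀ α ∈ Δ, ∃ c : ι → ℕ, θ - α = ∑ i, (c i : ℝ) • b i) (i : ι) :
    0 ≤ ⟪b i, θ⟫ := by
  have h := repr_le_repr_of_highest hθ (hΔ.reflect_mem (b i) (hb.mem i) θ hθΔ) i
  have hpos : 0 < ⟪b i, b i⟫ := real_inner_self_pos.mpr (b.ne_zero i)
  simp only [map_sub, map_smul, Finsupp.sub_apply, Finsupp.smul_apply, b.repr_self,
    Finsupp.single_eq_same, smul_eq_mul, mul_one] at h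
  have hq : 0 ≤ 2 * ⟪θ, b i⟫ / ⟪b i, b i⟫ := by linarith
  rw [real_inner_comm]
  have := (le_div_iff₀ hpos).mp hq
  linarith

/-- For an irreducible reduced crystallographic root system `Δ` with base `b`, positive
system `Δ⁺` and highest root `θ`: every positive root `α ≠ θ` satisfies
`⟨α, θ^∨⟩ = 2(α|θ)/(θ|θ) ∈ {0, 1}`, and `⟨θ, θ^∨⟩ = 2`. -/
theorem pairing_with_highest_coroot {V : Type*} [NormedAddCommGroup V]
    [InnerProductSpace ℝ V] [FiniteDimensional ℝ V] {ι : Type*} [Fintype ι]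
    (Δ : Finset V) (hΔ : IsRootSystem Δ) (hirr : IsIrreducibleRS Δ)
    (b : Module.Basis ι ℝ V) (hb : IsBase Δ b)
    (θ : V) (hθΔ : θ ∈ Δ)
    (hθ : ∀ α ∈ Δ, ∃ c : ι → ℕ, θ - α = ∑ i, (c i : ℝ) • b i) :
    (∀ α ∈ posRoots Δ b, α ≠ θ →
      2 * ⟪α, θ⟫ / ⟪θ, θ⟫ = 0 ∨ 2 * ⟪α, θ⟫ / ⟪θ, θ⟫ = 1) ∧
    2 * ⟪θ, θ⟫ / ⟪θ, θ⟫ = 2 := by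
  have hpos : 0 < ⟪θ, θ⟫ := real_inner_self_pos.mpr (hΔ.ne_zero θ hθΔ)
  refine ⟨fun α hα hne => ?_, mul_div_cancel_right₀ _ hpos.ne'⟩
  obtain ⟨hαΔ, hα0⟩ := Finset.mem_filter.mp hα
  have hinner : 0 ≤ ⟪α, θ⟫ := by
    rw [← b.sum_repr α, sum_inner]
    refine Finset.sum_nonneg fun i _ => ?_
    rw [real_inner_smul_left]
    exact mul_nonneg (hα0 i) (inner_base_highest_nonneg hΔ hb hθΔ hθ i)
  obtain ⟨n, hn⟩ := hΔ.crystallographic α hαΔ θ hθΔ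
  have hn0 : 0 ≤ n := by
    have : (0 : ℝ) ≤ n := hn ▸ by positivity
    exact_mod_cast this
  have hn1 : n ≤ 1 := by
    by_contra! hn2
    refine hne (b.ext_elem fun i => le_antisymm (repr_le_repr_of_highest hθ hαΔ i) ?_)
    -- the root `nθ - α` lies below `θ`, so `α ≥ (n - 1) θ ≥ θ`
    have hr := hΔ.reflect_mem θ hθΔ α hαΔ
    rw [hn] at hr
    have h := repr_le_repr_of_highest hθ (hΔ.neg_mem_s5 hr) i
    simp only [map_neg, map_sub, map_smul, Finsupp.neg_apply, Finsupp.sub_apply,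
      Finsupp.smul_apply, smul_eq_mul] at h
    have hn2' : (2 : ℝ) ≤ n := by exact_mod_cast hn2
    nlinarith [repr_nonneg_of_highest hΔ hθΔ hθ i]
  rw [hn]
  obtain rfl | rfl : n = 0 ∨ n = 1 := by lia
  · simp
  · simp
end
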